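/- arXiv:2309.13870 — 2 statements merged into one kernel-verified Lean document; each statement's English description precedes it below -/
import Mathlib

section
/- Let m,n ≥ 1 and let μ ⊆ m^n be a partition. Then each of the following three identities of rational functions in u over ℚ(α) holds (i.e., each of the three factors in the quadrant decomposition of T_{μ*μ̄} is invariant under replacing μ by μ̄): (i) ∏_{b∈μ} (u−[b])/(u−[b̄]) = ∏_{b∈μ̄} (u−[b])/(u−[b̄]); (ii) ∏_{b∈μ̄} (u−[v⁻ − h⁻_{μ̄}(b)])/(u−[v⁻ − h⁻_{m^n}(b̌)]) = ∏_{b∈μ} (u−[v⁻ − h⁻_{μ}(b)])/(u−[v⁻ − h⁻_{m^n}(b̌)]); (iii) ∏_{b∈μ} (u−[v⁻ + h⁺_{μ}(b)])/(u−[v⁻ + h⁺_{m^n}(b̂)]) = ∏_{b∈μ̄} (u−[v⁻ + h⁺_{μ̄}(b)])/(u−[v⁻ + h⁺_{m^n}(b̂)]). -/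
/-!
Common setup: boxes, Young diagrams as finite lower sets of boxes (French notation),
arms, legs, hooks, the field `ℚ(α)`, rational functions in `u` over `ℚ(α)`,
the functions `T_Γ`, corners, star products, rectangles and complements.
-/

open scoped BigOperators

attribute [local instance] Classical.propDecidable

namespace JackLR

/-- A box `(x, y)`: `x` is the column index, `y` the row index (French notation). -/
abbrev Box := ℕ × ℕ

/-- The field `ℚ(α)`. -/
abbrev K := RatFunc ℚ

/-- Rational functions in a variable `u` with coefficients in `ℚ(α)`. -/
abbrev F := RatFunc K

/-- The indeterminate `α`. -/
noncomputable def alpha : K := RatFunc.X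

/-- `[c] := α·x − y` for `c = (x, y) ∈ ℤ²`. -/
noncomputable def brk (c : ℤ × ℤ) : K := alpha * (c.1 : K) - (c.2 : K)

/-- The embedding of a box into `ℤ²`. -/
def zb (b : Box) : ℤ × ℤ := ((b.1 : ℤ), (b.2 : ℤ))

/-- `[b]` for a box `b`. -/
noncomputable def brkN (b : Box) : K := brk (zb b)

/-- `S` is the set of boxes of a Young diagram (equivalently, of a partition). -/
def IsYoung (S : Finset Box) : Prop := IsLowerSet (↑S : Set Box)

/-- The arm of `s`: number of boxes of `S` strictly to the right of `s` in its row. -/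
def arm (S : Finset Box) (s : Box) : ℕ := (S.filter fun b => b.2 = s.2 ∧ s.1 < b.1).card

/-- The leg of `s`: number of boxes of `S` strictly above `s` in its column. -/
def leg (S : Finset Box) (s : Box) : ℕ := (S.filter fun b => b.1 = s.1 ∧ s.2 < b.2).card

/-- Upper hook vector `h⁺_S(s) = (arm+1, −leg)`. -/
def hup (S : Finset Box) (s : Box) : ℤ × ℤ := ((arm S s : ℤ) + 1, -(leg S s : ℤ))

/-- Lower hook vector `h⁻_S(s) = (arm, −leg−1)`. -/
def hlo (S : Finset Box) (s : Box) : ℤ × ℤ := ((arm S s : ℤ), -((leg S s : ℤ) + 1))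

/-- Upper hook value `uh_S(s) = α(arm+1) + leg`. -/
noncomputable def uh (S : Finset Box) (s : Box) : K := brk (hup S s)

/-- Lower hook value `lh_S(s) = α·arm + leg + 1`. -/
noncomputable def lh (S : Finset Box) (s : Box) : K := brk (hlo S s)

/-- The variable `u`. -/
noncomputable def uu : F := RatFunc.X

/-- `T_□(w) = (w−[0,0])(w−[1,1]) / ((w−[1,0])(w−[0,1]))`. -/
noncomputable def Tbox (w : F) : F :=
  ((w - RatFunc.C (brk (0, 0))) * (w - RatFunc.C (brk (1, 1)))) /
    ((w - RatFunc.C (brk (1, 0))) * (w - RatFunc.C (brk (0, 1))))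

/-- `T_Γ` with the variable `u` replaced by `w`. -/
noncomputable def TMat (Γ : Multiset Box) (w : F) : F :=
  (Γ.map fun b => Tbox (w - RatFunc.C (brkN b))).prod

/-- `T_Γ(u) = ∏_{b ∈ Γ} T_□(u − [b])` for a finite multiset `Γ` of boxes. -/
noncomputable def TM (Γ : Multiset Box) : F := TMat Γ uu

/-- `T_S(u)` for a finite set `S` of boxes. -/
noncomputable def TS (S : Finset Box) : F := TM S.val

/-- The star product `μ * ν` as the multiset `{s + t : s ∈ μ, t ∈ ν}` with multiplicity. -/
def star (μ ν : Finset Box) : Multiset Box :=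
  μ.val.bind fun s => ν.val.map fun t => (s.1 + t.1, s.2 + t.2)

/-- The rectangular partition `m^n` (n rows of length m). -/
def rect (m n : ℕ) : Finset Box := Finset.range m ×ˢ Finset.range n

/-- `v⁻ = (m−1, n−1)`. -/
def vminus (m n : ℕ) : Box := (m - 1, n - 1)

/-- `b̄ := v⁻ − b`. -/
def conjBox (m n : ℕ) (b : Box) : Box := (m - 1 - b.1, n - 1 - b.2)

/-- The complement partition of `μ ⊆ m^n` inside `m^n`, with boxes `{v⁻ − b : b ∈ m^n, b ∉ μ}`. -/
def complIn (m n : ℕ) (μ : Finset Box) : Finset Box := (rect m n \ μ).image (conjBox m n)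

/-- `b̂ := (m−1−b₁, b₂)`. -/
def hflip (m : ℕ) (b : Box) : Box := (m - 1 - b.1, b.2)

/-- `b̌ := (b₁, n−1−b₂)`. -/
def vflip (n : ℕ) (b : Box) : Box := (b.1, n - 1 - b.2)

/-- Inner corners `I_S`: removable boxes. -/
def Inner (S : Finset Box) : Finset Box :=
  S.filter fun s => (s.1 + 1, s.2) ∉ S ∧ (s.1, s.2 + 1) ∉ S

/-- `t` can be added to `S` to give again a Young diagram. -/
def addable (S : Finset Box) (t : Box) : Prop :=
  t ∉ S ∧ (t.1 = 0 ∨ (t.1 - 1, t.2) ∈ S) ∧ (t.2 = 0 ∨ (t.1, t.2 - 1) ∈ S)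

/-- Outer corners `O_S`: addable boxes (these all satisfy the bounds used below). -/
noncomputable def Outer (S : Finset Box) : Finset Box :=
  ((Finset.range (S.sup Prod.fst + 2)) ×ˢ (Finset.range (S.sup Prod.snd + 2))).filter
    fun t => addable S t

/-- `I⁺_S = {s + (1,1) : s ∈ I_S}`. -/
noncomputable def Iplus (S : Finset Box) : Finset Box :=
  (Inner S).image fun s => (s.1 + 1, s.2 + 1)

/-- `R^s_S` : boxes of `S` in the same row as `s`. -/
def rowOf (S : Finset Box) (s : Box) : Finset Box := S.filter fun b => b.2 = s.2

/-- `C^s_S` : boxes of `S` in the same column as `s`. -/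
def colOf (S : Finset Box) (s : Box) : Finset Box := S.filter fun b => b.1 = s.1

/-- `a ∧ b := (min a₁ b₁, min a₂ b₂)`. -/
def meet (a b : Box) : Box := (min a.1 b.1, min a.2 b.2)

/-- Pole order of `f` at `u = c`: multiplicity of `(u − c)` in the denominator minus its
multiplicity in the numerator, `f` being written in lowest terms. -/
noncomputable def polOrder (f : F) (c : K) : ℤ :=
  (f.denom.rootMultiplicity c : ℤ) - (f.num.rootMultiplicity c : ℤ)

/-- `ϖ_S = ∏_{b ∈ S, b ≠ (0,0)} [b]`. -/
noncomputable def varpi (S : Finset Box) : K := ∏ b ∈ S.erase (0, 0), brkN b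

section HookSums

open Finset

variable {A : Type*} [AddCommGroup A]

theorem sum_Ico_sub_one_sub (f : ℕ → A) {a b c : ℕ} (hab : a ≤ b) (hbc : b ≤ c) :
    ∑ x ∈ Ico a b, f (c - 1 - x) = ∑ k ∈ range (c - a), f k - ∑ k ∈ range (c - b), f k := by
  induction b, hab using Nat.le_induction with
  | base => simp
  | succ b hab ih =>
    rw [sum_Ico_succ_top hab, ih (by omega), show c - b = c - (b + 1) + 1 by omega,
      sum_range_succ, show c - 1 - b = c - (b + 1) by omega]
    abel

/-- The boxes of a Young diagram in row `y` are those with first coordinate below `colLen y`. -/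
theorem sum_cells_eq (D : YoungDiagram) {n : ℕ} (hn : D.colLen n = 0) (f : Box → A) :
    ∑ b ∈ D.cells, f b = ∑ y ∈ range n, ∑ x ∈ range (D.colLen y), f (x, y) := by
  refine sum_finset_product_right _ _ _ ?_
  rintro ⟨x, y⟩
  simp only [mem_range, YoungDiagram.mem_cells, YoungDiagram.mem_iff_lt_colLen]
  refine ⟨fun h => ⟨?_, h⟩, fun h => h.2⟩
  by_contra hy
  have := D.colLen_anti n y (by omega)
  omega

theorem arm_cells (D : YoungDiagram) (b : Box) :
    arm D.cells b = D.colLen b.2 - 1 - b.1 := by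
  have : (D.cells.filter fun c => c.2 = b.2 ∧ b.1 < c.1) = Ioo b.1 (D.colLen b.2) ×ˢ {b.2} := by
    ext ⟨x, y⟩
    simp only [mem_filter, YoungDiagram.mem_cells, YoungDiagram.mem_iff_lt_colLen, mem_product,
      mem_Ioo, mem_singleton]
    constructor
    · rintro ⟨h, rfl, h'⟩
      exact ⟨⟨h', h⟩, rfl⟩
    · rintro ⟨⟨h', h⟩, rfl⟩
      exact ⟨h, rfl, h'⟩
  rw [arm, this, card_product, Nat.card_Ioo, card_singleton]
  omega

theorem leg_cells (D : YoungDiagram) (b : Box) :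
    leg D.cells b = D.rowLen b.1 - 1 - b.2 := by
  have : (D.cells.filter fun c => c.1 = b.1 ∧ b.2 < c.2) = {b.1} ×ˢ Ioo b.2 (D.rowLen b.1) := by
    ext ⟨x, y⟩
    simp only [mem_filter, YoungDiagram.mem_cells, YoungDiagram.mem_iff_lt_rowLen, mem_product,
      mem_Ioo, mem_singleton]
    constructor
    · rintro ⟨h, rfl, h'⟩
      exact ⟨rfl, h', h⟩
    · rintro ⟨rfl, h', h⟩
      exact ⟨h, rfl, h'⟩
  rw [leg, this, card_product, Nat.card_Ioo, card_singleton]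
  omega

theorem rowLen_eq_succ (D : YoungDiagram) {x j : ℕ} (h : x < D.colLen j)
    (h' : D.colLen (j + 1) ≤ x) : D.rowLen x = j + 1 := by
  have h1 := YoungDiagram.mem_iff_lt_rowLen.1 (YoungDiagram.mem_iff_lt_colLen.2 h)
  have h2 : ¬ j + 1 < D.rowLen x := fun h3 => by
    have := YoungDiagram.mem_iff_lt_colLen.1 (YoungDiagram.mem_iff_lt_rowLen.2 h3)
    omega
  omega

theorem sum_row_hooks (D : YoungDiagram) (g : ℕ → ℕ → A) (i N : ℕ) (hN : i ≤ N) :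
    ∑ x ∈ Ico (D.colLen N) (D.colLen i), g (D.colLen i - 1 - x) (D.rowLen x - 1 - i) =
      ∑ j ∈ Ico i N, (∑ k ∈ range (D.colLen i - D.colLen j), g k (j - i - 1) -
        ∑ k ∈ range (D.colLen i - D.colLen j), g k (j - i)) +
      ∑ k ∈ range (D.colLen i - D.colLen N), g k (N - i - 1) := by
  induction N, hN using Nat.le_induction with
  | base => simp
  | succ N hN ih =>
    have h1 := D.colLen_anti N (N + 1) (by omega)
    have h2 := D.colLen_anti i N hN
    have h3 : ∑ x ∈ Ico (D.colLen (N + 1)) (D.colLen N),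
        g (D.colLen i - 1 - x) (D.rowLen x - 1 - i) =
        ∑ x ∈ Ico (D.colLen (N + 1)) (D.colLen N), g (D.colLen i - 1 - x) (N - i) := by
      refine sum_congr rfl fun x hx => ?_
      rw [mem_Ico] at hx
      rw [rowLen_eq_succ D hx.2 hx.1, Nat.add_sub_cancel]
    rw [← sum_Ico_consecutive _ h1 h2, ih, h3, sum_Ico_sub_one_sub (fun k => g k (N - i)) h1 h2,
      sum_Ico_succ_top hN, show N + 1 - i - 1 = N - i by omega]
    abel

/-- The part of a hook sum depending only on differences of row lengths. -/
def rowDiffSum (g : ℕ → ℕ → A) (n : ℕ) (L : ℕ → ℕ) : A :=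
  ∑ i ∈ range n, ∑ j ∈ Ico i n, (∑ k ∈ range (L i - L j), g k (j - i - 1) -
    ∑ k ∈ range (L i - L j), g k (j - i))

theorem rowDiffSum_compl (g : ℕ → ℕ → A) (m n : ℕ) (L L' : ℕ → ℕ)
    (hL : ∀ y < n, L y ≤ m) (hL' : ∀ y < n, L' y = m - L (n - 1 - y)) :
    rowDiffSum g n L' = rowDiffSum g n L := by
  simp only [rowDiffSum, sum_sigma']
  refine sum_nbij' (fun p => ⟨n - 1 - p.2, n - 1 - p.1⟩) (fun p => ⟨n - 1 - p.2, n - 1 - p.1⟩)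
    ?_ ?_ ?_ ?_ ?_
  · rintro ⟨i, j⟩ h
    simp only [mem_sigma, mem_range, mem_Ico] at h ⊢
    omega
  · rintro ⟨i, j⟩ h
    simp only [mem_sigma, mem_range, mem_Ico] at h ⊢
    omega
  · rintro ⟨i, j⟩ h
    simp only [mem_sigma, mem_range, mem_Ico] at h
    simp only [Sigma.mk.injEq, heq_eq_eq]
    omega
  · rintro ⟨i, j⟩ h
    simp only [mem_sigma, mem_range, mem_Ico] at h
    simp only [Sigma.mk.injEq, heq_eq_eq]
    omega
  · rintro ⟨i, j⟩ h
    simp only [mem_sigma, mem_range, mem_Ico] at h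
    have h1 := hL (n - 1 - i) (by omega)
    have h2 := hL (n - 1 - j) (by omega)
    simp only [hL' i h.1, hL' j h.2.2]
    rw [show n - 1 - i - (n - 1 - j) = j - i by omega,
      show m - L (n - 1 - i) - (m - L (n - 1 - j)) = L (n - 1 - j) - L (n - 1 - i) by omega]

theorem sum_hooks_add (D D' : YoungDiagram) (g : ℕ → ℕ → A) (m n : ℕ)
    (hn : D.colLen n = 0) (hn' : D'.colLen n = 0) (hL : ∀ y < n, D.colLen y ≤ m)
    (hL' : ∀ y < n, D'.colLen y = m - D.colLen (n - 1 - y)) :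
    ∑ b ∈ D.cells, g (arm D.cells b) (leg D.cells b) + ∑ b ∈ D'.cells, g (m - 1 - b.1) b.2 =
      rowDiffSum g n D.colLen + ∑ y ∈ range n, ∑ k ∈ range m, g k y := by
  have h1 : ∑ b ∈ D.cells, g (arm D.cells b) (leg D.cells b) = rowDiffSum g n D.colLen +
      ∑ y ∈ range n, ∑ k ∈ range (D.colLen y), g k (n - 1 - y) := by
    rw [sum_cells_eq D hn, rowDiffSum, ← sum_add_distrib]
    refine sum_congr rfl fun y hy => ?_
    have := sum_row_hooks D g y n (mem_range.1 hy).le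
    rw [hn, Nat.Ico_zero_eq_range, Nat.sub_zero, Nat.sub_right_comm] at this
    simpa only [arm_cells, leg_cells] using this
  have h2 : ∑ b ∈ D'.cells, g (m - 1 - b.1) b.2 = ∑ y ∈ range n, ∑ k ∈ range m, g k y -
      ∑ y ∈ range n, ∑ k ∈ range (D.colLen y), g k (n - 1 - y) := by
    rw [sum_cells_eq D' hn', ← sum_range_reflect
      (fun y => ∑ k ∈ range (D.colLen y), g k (n - 1 - y)), ← sum_sub_distrib]
    refine sum_congr rfl fun y hy => ?_
    rw [mem_range] at hy
    have h3 := hL (n - 1 - y) (by omega)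
    have h4 := sum_Ico_sub_one_sub (fun k => g k y) (Nat.zero_le (D'.colLen y))
      (show D'.colLen y ≤ m by rw [hL' y hy]; omega)
    rw [Nat.Ico_zero_eq_range, Nat.sub_zero] at h4
    rw [h4, hL' y hy, Nat.sub_sub_self h3, show n - 1 - (n - 1 - y) = y by omega]
  rw [h1, h2]
  abel

end HookSums

section Complement

variable {m n : ℕ} {μ : Finset Box}

theorem mem_rect {b : Box} : b ∈ rect m n ↔ b.1 < m ∧ b.2 < n := by
  simp [rect]

theorem conjBox_conjBox {b : Box} (hb : b ∈ rect m n) : conjBox m n (conjBox m n b) = b := by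
  rw [mem_rect] at hb
  ext <;> simp only [conjBox] <;> omega

theorem conjBox_mem_rect {b : Box} (hb : b ∈ rect m n) : conjBox m n b ∈ rect m n := by
  rw [mem_rect] at *
  simp only [conjBox]
  omega

theorem mem_complIn {b : Box} : b ∈ complIn m n μ ↔ b ∈ rect m n ∧ conjBox m n b ∉ μ := by
  simp only [complIn, Finset.mem_image, Finset.mem_sdiff]
  constructor
  · rintro ⟨c, ⟨hc, hcμ⟩, rfl⟩
    exact ⟨conjBox_mem_rect hc, by rwa [conjBox_conjBox hc]⟩
  · rintro ⟨hb, h⟩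
    exact ⟨_, ⟨conjBox_mem_rect hb, h⟩, conjBox_conjBox hb⟩

theorem complIn_subset : complIn m n μ ⊆ rect m n := fun _ h => (mem_complIn.1 h).1

theorem complIn_complIn (hsub : μ ⊆ rect m n) : complIn m n (complIn m n μ) = μ := by
  ext b
  simp only [mem_complIn, not_and, not_not]
  constructor
  · rintro ⟨hb, h⟩
    simpa only [conjBox_conjBox hb] using h (conjBox_mem_rect hb)
  · intro hb
    exact ⟨hsub hb, fun _ => by rwa [conjBox_conjBox (hsub hb)]⟩

theorem isYoung_complIn (hμ : IsYoung μ) : IsYoung (complIn m n μ) := by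
  intro a b hba ha
  rw [Finset.mem_coe, mem_complIn, mem_rect] at *
  obtain ⟨h1, h2⟩ := Prod.le_def.1 hba
  refine ⟨by omega, fun h => ha.2 (hμ ?_ h)⟩
  simp only [conjBox, Prod.mk_le_mk]
  omega

theorem prod_complIn_conjBox {M : Type*} [CommMonoid M] (f : Box → M) :
    ∏ b ∈ complIn m n μ, f (conjBox m n b) = ∏ b ∈ rect m n \ μ, f b := by
  rw [complIn, Finset.prod_image]
  · refine Finset.prod_congr rfl fun b hb => ?_
    rw [conjBox_conjBox (Finset.mem_sdiff.1 hb).1]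
  · intro a ha b hb hab
    rw [Finset.mem_coe, Finset.mem_sdiff] at ha hb
    rw [← conjBox_conjBox ha.1, hab, conjBox_conjBox hb.1]

theorem prod_mul_prod_complIn_conjBox {M : Type*} [CommMonoid M] (f : Box → M)
    (hsub : μ ⊆ rect m n) :
    (∏ b ∈ complIn m n μ, f (conjBox m n b)) * ∏ b ∈ μ, f b = ∏ b ∈ rect m n, f b := by
  rw [prod_complIn_conjBox, Finset.prod_sdiff hsub]

theorem sum_hooks_add_sum_complIn {A : Type*} [AddCommGroup A] (g : ℕ → ℕ → A)
    (hμ : IsYoung μ) (hsub : μ ⊆ rect m n) :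
    ∑ b ∈ μ, g (arm μ b) (leg μ b) + ∑ b ∈ complIn m n μ, g (m - 1 - b.1) b.2 =
      ∑ b ∈ complIn m n μ, g (arm (complIn m n μ) b) (leg (complIn m n μ) b) +
        ∑ b ∈ μ, g (m - 1 - b.1) b.2 := by
  set D : YoungDiagram := ⟨μ, hμ⟩
  set D' : YoungDiagram := ⟨complIn m n μ, isYoung_complIn hμ⟩
  have hD (x y : ℕ) : x < D.colLen y ↔ (x, y) ∈ μ := YoungDiagram.mem_iff_lt_colLen.symm
  have hD' (x y : ℕ) : x < D'.colLen y ↔ (x, y) ∈ complIn m n μ :=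
    YoungDiagram.mem_iff_lt_colLen.symm
  have hn {S : Finset Box} (hS : S ⊆ rect m n) (L : ℕ) (h : 0 < L ↔ (0, n) ∈ S) : L = 0 := by
    by_contra h0
    exact absurd (mem_rect.1 (hS (h.1 (Nat.pos_of_ne_zero h0)))).2 (lt_irrefl n)
  have hm {S : Finset Box} (hS : S ⊆ rect m n) (y L : ℕ) (h : m < L ↔ (m, y) ∈ S) : L ≤ m := by
    by_contra h0
    exact absurd (mem_rect.1 (hS (h.1 (not_le.1 h0)))).1 (lt_irrefl m)
  have hL (y : ℕ) : D.colLen y ≤ m := hm hsub y _ (hD m y)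
  have hL' (y : ℕ) : D'.colLen y ≤ m := hm complIn_subset y _ (hD' m y)
  have hrow (y : ℕ) (hy : y < n) : D'.colLen y = m - D.colLen (n - 1 - y) := by
    refine eq_of_forall_lt_iff fun x => ?_
    have := hL (n - 1 - y)
    simp only [hD', mem_complIn, mem_rect, conjBox, ← hD]
    omega
  have hrow' (y : ℕ) (hy : y < n) : D.colLen y = m - D'.colLen (n - 1 - y) := by
    have := hL y
    rw [hrow _ (by omega), show n - 1 - (n - 1 - y) = y by omega]
    omega
  have h0 := hn hsub _ (hD 0 n)
  have h0' := hn complIn_subset _ (hD' 0 n)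
  have h1 := sum_hooks_add D D' g m n h0 h0' (fun y _ => hL y) hrow
  have h2 := sum_hooks_add D' D g m n h0' h0 (fun y _ => hL' y) hrow'
  rw [rowDiffSum_compl g m n _ _ (fun y _ => hL y) hrow] at h2
  exact h1.trans h2.symm

theorem prod_hooks_mul_prod_complIn {E : Type*} [Field E] (g : ℕ → ℕ → E)
    (hg : ∀ a l, g a l ≠ 0) (hμ : IsYoung μ) (hsub : μ ⊆ rect m n) :
    (∏ b ∈ μ, g (arm μ b) (leg μ b)) * ∏ b ∈ complIn m n μ, g (m - 1 - b.1) b.2 =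
      (∏ b ∈ complIn m n μ, g (arm (complIn m n μ) b) (leg (complIn m n μ) b)) *
        ∏ b ∈ μ, g (m - 1 - b.1) b.2 := by
  have h := congrArg (fun a : Additive Eˣ => (a.toMul : E))
    (sum_hooks_add_sum_complIn (fun a l => Additive.ofMul (Units.mk0 _ (hg a l))) hμ hsub)
  simpa using h

end Complement

theorem uu_sub_C_ne_zero (c : K) : uu - RatFunc.C c ≠ 0 := by
  have h := (map_ne_zero_iff (algebraMap (Polynomial K) F) (RatFunc.algebraMap_injective K)).2
    (Polynomial.X_sub_C_ne_zero c)
  simpa [uu] using h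

theorem vminus_sub_hlo {m n : ℕ} (hm : 1 ≤ m) (hn : 1 ≤ n) (S : Finset Box) (b : Box) :
    zb (vminus m n) - hlo S b = ((m : ℤ) - 1 - (arm S b : ℕ), (n : ℤ) + (leg S b : ℕ)) := by
  ext <;> simp only [zb, vminus, hlo, Prod.fst_sub, Prod.snd_sub] <;> omega

theorem vminus_add_hup {m n : ℕ} (hm : 1 ≤ m) (hn : 1 ≤ n) (S : Finset Box) (b : Box) :
    zb (vminus m n) + hup S b = ((m : ℤ) + (arm S b : ℕ), (n : ℤ) - 1 - (leg S b : ℕ)) := by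
  ext <;> simp only [zb, vminus, hup, Prod.fst_add, Prod.snd_add] <;> omega

theorem arm_rect {m n : ℕ} {b : Box} (hb : b ∈ rect m n) : arm (rect m n) b = m - 1 - b.1 := by
  rw [mem_rect] at hb
  have : ((rect m n).filter fun c => c.2 = b.2 ∧ b.1 < c.1) =
      Finset.Ioo b.1 m ×ˢ {b.2} := by
    ext c
    simp only [Finset.mem_filter, mem_rect, Finset.mem_product, Finset.mem_Ioo,
      Finset.mem_singleton]
    omega
  rw [arm, this, Finset.card_product, Nat.card_Ioo, Finset.card_singleton]
  omega

theorem leg_rect {m n : ℕ} {b : Box} (hb : b ∈ rect m n) : leg (rect m n) b = n - 1 - b.2 := by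
  rw [mem_rect] at hb
  have : ((rect m n).filter fun c => c.1 = b.1 ∧ b.2 < c.2) =
      {b.1} ×ˢ Finset.Ioo b.2 n := by
    ext c
    simp only [Finset.mem_filter, mem_rect, Finset.mem_product, Finset.mem_Ioo,
      Finset.mem_singleton]
    omega
  rw [leg, this, Finset.card_product, Nat.card_Ioo, Finset.card_singleton]
  omega

theorem vflip_mem_rect {m n : ℕ} {b : Box} (hb : b ∈ rect m n) : vflip n b ∈ rect m n := by
  rw [mem_rect] at *
  simp only [vflip]
  omega

theorem hflip_mem_rect {m n : ℕ} {b : Box} (hb : b ∈ rect m n) : hflip m b ∈ rect m n := by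
  rw [mem_rect] at *
  simp only [hflip]
  omega

theorem vminus_sub_hlo_rect {m n : ℕ} {b : Box} (hb : b ∈ rect m n) :
    zb (vminus m n) - hlo (rect m n) (vflip n b) =
      ((m : ℤ) - 1 - (m - 1 - b.1 : ℕ), (n : ℤ) + (b.2 : ℕ)) := by
  have h := mem_rect.1 hb
  rw [vminus_sub_hlo (by omega) (by omega), arm_rect (vflip_mem_rect hb),
    leg_rect (vflip_mem_rect hb)]
  ext <;> simp only [vflip]
  omega

theorem vminus_add_hup_rect {m n : ℕ} {b : Box} (hb : b ∈ rect m n) :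
    zb (vminus m n) + hup (rect m n) (hflip m b) = ((m : ℤ) + (b.1 : ℕ), (b.2 : ℤ)) := by
  have h := mem_rect.1 hb
  rw [vminus_add_hup (by omega) (by omega), arm_rect (hflip_mem_rect hb),
    leg_rect (hflip_mem_rect hb)]
  ext <;> simp only [hflip] <;> omega

/-- Each of the three quadrant factors of `T_{μ*μ̄}` is invariant under
replacing `μ` by its complement `μ̄` in `m^n`. -/
theorem stmt1 (m n : ℕ) (hm : 1 ≤ m) (hn : 1 ≤ n) (μ : Finset Box)
    (hμ : IsYoung μ) (hsub : μ ⊆ rect m n) :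
    ((∏ b ∈ μ, (uu - RatFunc.C (brkN b)) / (uu - RatFunc.C (brkN (conjBox m n b)))) =
      ∏ b ∈ complIn m n μ,
        (uu - RatFunc.C (brkN b)) / (uu - RatFunc.C (brkN (conjBox m n b)))) ∧
    ((∏ b ∈ complIn m n μ,
        (uu - RatFunc.C (brk (zb (vminus m n) - hlo (complIn m n μ) b))) /
          (uu - RatFunc.C (brk (zb (vminus m n) - hlo (rect m n) (vflip n b))))) =
      ∏ b ∈ μ,
        (uu - RatFunc.C (brk (zb (vminus m n) - hlo μ b))) /
          (uu - RatFunc.C (brk (zb (vminus m n) - hlo (rect m n) (vflip n b))))) ∧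
    ((∏ b ∈ μ,
        (uu - RatFunc.C (brk (zb (vminus m n) + hup μ b))) /
          (uu - RatFunc.C (brk (zb (vminus m n) + hup (rect m n) (hflip m b))))) =
      ∏ b ∈ complIn m n μ,
        (uu - RatFunc.C (brk (zb (vminus m n) + hup (complIn m n μ) b))) /
          (uu - RatFunc.C (brk (zb (vminus m n) + hup (rect m n) (hflip m b))))) := by
  have hν : complIn m n μ ⊆ rect m n := complIn_subset
  have hne {ι : Type} (s : Finset ι) (c : ι → K) : ∏ i ∈ s, (uu - RatFunc.C (c i)) ≠ 0 :=
    Finset.prod_ne_zero_iff.2 fun i _ => uu_sub_C_ne_zero (c i)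
  simp only [Finset.prod_div_distrib]
  refine ⟨?_, ?_, ?_⟩ <;> rw [div_eq_div_iff (hne _ _) (hne _ _)]
  · have h1 := prod_mul_prod_complIn_conjBox (fun b => uu - RatFunc.C (brkN b)) hsub
    have h2 := prod_mul_prod_complIn_conjBox (fun b => uu - RatFunc.C (brkN b)) hν
    rw [complIn_complIn hsub] at h2
    linear_combination h1 - h2
  · have h := prod_hooks_mul_prod_complIn
      (fun a l => uu - RatFunc.C (brk ((m : ℤ) - 1 - (a : ℕ), (n : ℤ) + (l : ℕ))))
      (fun _ _ => uu_sub_C_ne_zero _) hμ hsub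
    have hden {S : Finset Box} (hS : S ⊆ rect m n) :
        ∏ b ∈ S, (uu - RatFunc.C (brk (zb (vminus m n) - hlo (rect m n) (vflip n b)))) =
        ∏ b ∈ S, (uu - RatFunc.C (brk ((m : ℤ) - 1 - (m - 1 - b.1 : ℕ), (n : ℤ) + (b.2 : ℕ)))) :=
      Finset.prod_congr rfl fun b hb => by rw [vminus_sub_hlo_rect (hS hb)]
    rw [hden hsub, hden hν]
    simp only [vminus_sub_hlo hm hn]
    exact h.symm
  · have h := prod_hooks_mul_prod_complIn
      (fun a l => uu - RatFunc.C (brk ((m : ℤ) + (a : ℕ), (n : ℤ) - 1 - (l : ℕ))))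
      (fun _ _ => uu_sub_C_ne_zero _) hμ hsub
    set v : Box → F := fun b => uu - RatFunc.C (brk ((m : ℤ) + (b.1 : ℕ), (b.2 : ℤ))) with hv
    have hconj {S : Finset Box} (hS : S ⊆ rect m n) :
        ∏ b ∈ S, (uu - RatFunc.C (brk ((m : ℤ) + (m - 1 - b.1 : ℕ), (n : ℤ) - 1 - (b.2 : ℕ)))) =
        ∏ b ∈ S, v (conjBox m n b) :=
      Finset.prod_congr rfl fun b hb => by
        have := mem_rect.1 (hS hb)
        rw [hv, conjBox, show (n : ℤ) - 1 - (b.2 : ℕ) = (n - 1 - b.2 : ℕ) by omega]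
    have hden {S : Finset Box} (hS : S ⊆ rect m n) :
        ∏ b ∈ S, (uu - RatFunc.C (brk (zb (vminus m n) + hup (rect m n) (hflip m b)))) =
        ∏ b ∈ S, v b :=
      Finset.prod_congr rfl fun b hb => by rw [vminus_add_hup_rect (hS hb)]
    rw [hden hsub, hden hν]
    simp only [vminus_add_hup hm hn]
    simp only [hconj hsub, hconj hν] at h
    have h1 := prod_mul_prod_complIn_conjBox v hsub
    have h2 := prod_mul_prod_complIn_conjBox v hν
    rw [complIn_complIn hsub] at h2
    refine mul_right_cancel₀ (hne μ fun b => brk ((m : ℤ) + ((conjBox m n b).1 : ℕ),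
      ((conjBox m n b).2 : ℤ))) ?_
    change _ * ∏ b ∈ μ, v (conjBox m n b) = _ * ∏ b ∈ μ, v (conjBox m n b)
    linear_combination (∏ b ∈ μ, v b) * h +
      (∏ b ∈ μ, (uu - RatFunc.C (brk ((m : ℤ) + (arm μ b : ℕ), (n : ℤ) - 1 - (leg μ b : ℕ))))) *
        (h2 - h1)

end JackLR
end

section
/- (Expansion Lemma) Let σ be a partition and s ∈ I_σ, and write s⁺ := s+(1,1). Then, as an identity of rational functions in u over ℚ(α): T_σ(u) = u·(u−[s⁺]) · (∏_{b∈R^s_{σ∖s}} (u−[s⁺ − h⁺_{σ∖s}(b)]) / ∏_{b∈R^s_{σ}} (u−[s⁺ − h⁺_{σ}(b)])) · (∏_{b∈C^s_{σ∖s}} (u−[s⁺ + h⁻_{σ∖s}(b)]) / ∏_{b∈C^s_{σ}} (u−[s⁺ + h⁻_{σ}(b)])). -/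
/-!
Common setup: boxes, Young diagrams as finite lower sets of boxes (French notation),
arms, legs, hooks, the field `ℚ(α)`, rational functions in `u` over `ℚ(α)`,
the functions `T_Γ`, corners, star products, rectangles and complements.
-/

open scoped BigOperators

attribute [local instance] Classical.propDecidable

namespace JackLR

/-- The linear factor `u − [(x, y)]`. -/
noncomputable def linFactor (x y : ℕ) : F := uu - RatFunc.C (brkN (x, y))

theorem linFactor_ne_zero (x y : ℕ) : linFactor x y ≠ 0 := by
  have h := RatFunc.algebraMap_ne_zero (Polynomial.X_sub_C_ne_zero (brkN (x, y)))
  rwa [map_sub, RatFunc.algebraMap_X, RatFunc.algebraMap_C] at h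

theorem brk_add (a b : ℤ × ℤ) : brk (a + b) = brk a + brk b := by
  simp only [brk, Prod.fst_add, Prod.snd_add, Int.cast_add]
  ring

theorem uu_sub_brkN_sub (x y i j : ℕ) :
    uu - RatFunc.C (brkN (x, y)) - RatFunc.C (brk ((i : ℤ), (j : ℤ))) =
      linFactor (x + i) (y + j) := by
  have h : brkN (x + i, y + j) = brkN (x, y) + brk ((i : ℤ), (j : ℤ)) := by
    simp only [brkN, ← brk_add, zb, Prod.mk_add_mk, Nat.cast_add]
  rw [linFactor, h, map_add, sub_sub]

theorem Tbox_uu_sub (x y : ℕ) :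
    Tbox (uu - RatFunc.C (brkN (x, y))) =
      linFactor x y * linFactor (x + 1) (y + 1) /
        (linFactor (x + 1) y * linFactor x (y + 1)) := by
  have h := uu_sub_brkN_sub x y
  have h00 := h 0 0
  have h11 := h 1 1
  have h10 := h 1 0
  have h01 := h 0 1
  push_cast at h00 h11 h10 h01
  rw [Tbox, h00, h11, h10, h01]
  simp only [add_zero]

theorem linFactor_zero_zero : linFactor 0 0 = uu := by
  simp [linFactor, brkN, brk, zb]

theorem uu_sub_brk_eq_linFactor {c : ℤ × ℤ} {x y : ℕ} (hx : c.1 = x) (hy : c.2 = y) :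
    uu - RatFunc.C (brk c) = linFactor x y := by
  rw [linFactor, brkN, zb, ← hx, ← hy]

theorem leg_eq {S : Finset Box} {x y n : ℕ} (h : ∀ j, y < j → ((x, j) ∈ S ↔ j < n)) :
    leg S (x, y) = n - (y + 1) := by
  have hS : (S.filter fun b => b.1 = x ∧ y < b.2) = (Finset.Ico (y + 1) n).image (Prod.mk x) := by
    ext ⟨a, b⟩
    simp only [Finset.mem_filter, Finset.mem_image, Finset.mem_Ico, Prod.mk.injEq]
    constructor
    · rintro ⟨h1, rfl, h2⟩
      exact ⟨b, ⟨h2, (h b h2).1 h1⟩, rfl, rfl⟩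
    · rintro ⟨j, ⟨h1, h2⟩, rfl, rfl⟩
      exact ⟨(h j h1).2 h2, rfl, h1⟩
  rw [leg, hS, Finset.card_image_of_injective _ (Prod.mk_right_injective x), Nat.card_Ico]

theorem arm_eq {S : Finset Box} {x y n : ℕ} (h : ∀ i, x < i → ((i, y) ∈ S ↔ i < n)) :
    arm S (x, y) = n - (x + 1) := by
  have hS : (S.filter fun b => b.2 = y ∧ x < b.1) =
      (Finset.Ico (x + 1) n).image (fun i => (i, y)) := by
    ext ⟨a, b⟩
    simp only [Finset.mem_filter, Finset.mem_image, Finset.mem_Ico, Prod.mk.injEq]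
    constructor
    · rintro ⟨h1, rfl, h2⟩
      exact ⟨a, ⟨h2, (h a h2).1 h1⟩, rfl, rfl⟩
    · rintro ⟨j, ⟨h1, h2⟩, rfl, rfl⟩
      exact ⟨(h j h1).2 h2, rfl, h1⟩
  rw [arm, hS, Finset.card_image_of_injective _ (Prod.mk_left_injective y), Nat.card_Ico]

theorem prod_rowOf {S : Finset Box} {s : Box} {n : ℕ} (h : ∀ i, (i, s.2) ∈ S ↔ i < n)
    (g : Box → F) : ∏ b ∈ rowOf S s, g b = ∏ i ∈ Finset.range n, g (i, s.2) := by
  have hS : rowOf S s = (Finset.range n).image (fun i => (i, s.2)) := by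
    ext ⟨a, b⟩
    simp only [rowOf, Finset.mem_filter, Finset.mem_image, Finset.mem_range, Prod.mk.injEq]
    constructor
    · rintro ⟨h1, rfl⟩
      exact ⟨a, (h a).1 h1, rfl, rfl⟩
    · rintro ⟨i, h1, rfl, rfl⟩
      exact ⟨(h i).2 h1, rfl⟩
  rw [hS, Finset.prod_image (Prod.mk_left_injective s.2).injOn]

theorem prod_colOf {S : Finset Box} {s : Box} {n : ℕ} (h : ∀ j, (s.1, j) ∈ S ↔ j < n)
    (g : Box → F) : ∏ b ∈ colOf S s, g b = ∏ j ∈ Finset.range n, g (s.1, j) := by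
  have hS : colOf S s = (Finset.range n).image (Prod.mk s.1) := by
    ext ⟨a, b⟩
    simp only [colOf, Finset.mem_filter, Finset.mem_image, Finset.mem_range, Prod.mk.injEq]
    constructor
    · rintro ⟨h1, rfl⟩
      exact ⟨b, (h b).1 h1, rfl, rfl⟩
    · rintro ⟨i, h1, rfl, rfl⟩
      exact ⟨(h i).2 h1, rfl⟩
  rw [hS, Finset.prod_image (Prod.mk_right_injective s.1).injOn]

section Telescope

variable {L : Type*} [Field L] {f : ℕ → ℕ → L}

theorem prod_Ico_succ_div {g : ℕ → L} (hg : ∀ i, g i ≠ 0) {m n : ℕ} (hmn : m ≤ n) :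
    ∏ i ∈ Finset.Ico m n, g (i + 1) / g i = g n / g m := by
  induction n, hmn using Nat.le_induction with
  | base => simp [hg m]
  | succ n hmn ih =>
    rw [Finset.prod_Ico_succ_top hmn, ih, mul_comm, div_mul_div_cancel₀ (hg n)]

theorem prod_cross_ratio_column (hf : ∀ x y, f x y ≠ 0) (x n : ℕ) :
    ∏ y ∈ Finset.range n, f x y * f (x + 1) (y + 1) / (f (x + 1) y * f x (y + 1)) =
      f x 0 * f (x + 1) n / (f (x + 1) 0 * f x n) := by
  have h := prod_Ico_succ_div (g := fun y => f (x + 1) y / f x y)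
    (fun y => div_ne_zero (hf _ _) (hf _ _)) (Nat.zero_le n)
  calc _ = ∏ y ∈ Finset.Ico 0 n, f (x + 1) (y + 1) / f x (y + 1) / (f (x + 1) y / f x y) := by
        rw [Finset.range_eq_Ico]
        refine Finset.prod_congr rfl fun y _ => ?_
        rw [div_div_div_eq]
        ring
    _ = _ := by
        rw [h, div_div_div_eq]
        ring

theorem prod_cross_ratio_row (hf : ∀ x y, f x y ≠ 0) (y : ℕ) {m n : ℕ} (hmn : m ≤ n) :
    ∏ x ∈ Finset.Ico m n, f x y * f (x + 1) (y + 1) / (f (x + 1) y * f x (y + 1)) =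
      f m y * f n (y + 1) / (f n y * f m (y + 1)) := by
  have h := prod_Ico_succ_div (g := fun x => f x (y + 1) / f x y)
    (fun y => div_ne_zero (hf _ _) (hf _ _)) hmn
  calc _ = ∏ x ∈ Finset.Ico m n, f (x + 1) (y + 1) / f (x + 1) y / (f x (y + 1) / f x y) := by
        refine Finset.prod_congr rfl fun y _ => ?_
        rw [div_div_div_eq]
        ring
    _ = _ := by
        rw [h, div_div_div_eq]
        ring

/-- Columns weakly left of the corner `(p, q)` telescope vertically, the boxes strictly right of it
telescope horizontally. -/
theorem prod_cross_ratio_corner (hf : ∀ x y, f x y ≠ 0) (μ : YoungDiagram) {p q : ℕ}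
    (hp : μ.rowLen p = q + 1) (hq : μ.colLen q = p + 1) :
    ∏ b ∈ μ.cells, f b.1 b.2 * f (b.1 + 1) (b.2 + 1) / (f (b.1 + 1) b.2 * f b.1 (b.2 + 1)) =
      f 0 0 * f (p + 1) (q + 1) *
        ((∏ x ∈ Finset.range p, f (x + 1) (μ.rowLen x)) /
          ∏ x ∈ Finset.range (p + 1), f x (μ.rowLen x)) *
        ((∏ y ∈ Finset.range q, f (μ.colLen y) (y + 1)) /
          ∏ y ∈ Finset.range (q + 1), f (μ.colLen y) y) := by
  have hcol : ∀ y ∈ Finset.range q, p + 1 ≤ μ.colLen y := fun y hy =>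
    hq ▸ μ.colLen_anti y q (Finset.mem_range.1 hy).le
  rw [← Finset.prod_filter_mul_prod_filter_not μ.cells (fun b => b.1 < p + 1),
    Finset.prod_finset_product _ (Finset.range (p + 1)) (fun x => Finset.range (μ.rowLen x)),
    Finset.prod_finset_product_right _ (Finset.range q)
      (fun y => Finset.Ico (p + 1) (μ.colLen y))]
  rotate_left
  · rintro ⟨x, y⟩
    simp only [Finset.mem_filter, YoungDiagram.mem_cells, YoungDiagram.mem_iff_lt_colLen,
      Finset.mem_range, Finset.mem_Ico]
    have hanti := fun h : q ≤ y => μ.colLen_anti q y h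
    grind
  · rintro ⟨x, y⟩
    simp only [Finset.mem_filter, YoungDiagram.mem_cells, YoungDiagram.mem_iff_lt_rowLen,
      Finset.mem_range]
    tauto
  simp only [prod_cross_ratio_column hf]
  rw [Finset.prod_congr rfl fun y hy => prod_cross_ratio_row hf y (hcol y hy)]
  have hbottom := prod_Ico_succ_div (g := fun x => f x 0) (fun x => hf x 0) (Nat.zero_le (p + 1))
  have hside := prod_Ico_succ_div (g := fun y => f (p + 1) y) (hf (p + 1)) (Nat.zero_le q)
  rw [← Finset.range_eq_Ico, Finset.prod_div_distrib] at hbottom hside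
  have hne : ∀ (s : Finset ℕ) (g k : ℕ → ℕ), ∏ i ∈ s, f (g i) (k i) ≠ 0 := fun s g k =>
    Finset.prod_ne_zero_iff.2 fun i _ => hf _ _
  have h1 := hne (Finset.range (p + 1)) id (fun _ => 0)
  have h2 := hne (Finset.range (p + 1)) (· + 1) (fun _ => 0)
  have h3 := hne (Finset.range q) (fun _ => p + 1) id
  have h4 := hne (Finset.range q) (fun _ => p + 1) (· + 1)
  have h5 := hne (Finset.range (p + 1)) id μ.rowLen
  have h6 := hne (Finset.range q) μ.colLen id
  simp only [id] at h1 h2 h3 h4 h5 h6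
  simp only [Finset.prod_div_distrib, Finset.prod_mul_distrib]
  rw [Finset.prod_range_succ (fun x => f (x + 1) (μ.rowLen x)),
    Finset.prod_range_succ (fun y => f (μ.colLen y) y), hp, hq]
  have f1 := hf 0 0
  have f2 := hf (p + 1) 0
  have f3 := hf (p + 1) q
  rw [div_eq_div_iff h1 f1] at hbottom
  rw [div_eq_div_iff h3 f2] at hside
  generalize ∏ x ∈ Finset.range (p + 1), f x 0 = A1 at *
  generalize ∏ x ∈ Finset.range (p + 1), f (x + 1) 0 = A2 at *
  generalize ∏ x ∈ Finset.range q, f (p + 1) x = A3 at *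
  generalize ∏ x ∈ Finset.range q, f (p + 1) (x + 1) = A4 at *
  have key : A1 * A3 * f (p + 1) q = f 0 0 * (A2 * A4) := by
    apply mul_left_cancel₀ f2
    linear_combination (-A3 * f (p + 1) q) * hbottom - A2 * f 0 0 * hside
  field_simp
  linear_combination (∏ x ∈ Finset.range p, f (x + 1) (μ.rowLen x)) * f (p + 1) (q + 1) *
    (∏ y ∈ Finset.range q, f (μ.colLen y) (y + 1)) * key

end Telescope

/-- **Expansion Lemma.** Expansion of `T_σ` as a row–column product
relative to an inner corner `s ∈ I_σ`. -/
theorem stmt4 (σ : Finset Box) (hσ : IsYoung σ) (s : Box) (hs : s ∈ Inner σ) :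
    TS σ =
      uu * (uu - RatFunc.C (brkN (s.1 + 1, s.2 + 1))) *
        ((∏ b ∈ rowOf (σ.erase s) s,
            (uu - RatFunc.C (brk (zb (s.1 + 1, s.2 + 1) - hup (σ.erase s) b)))) /
          ∏ b ∈ rowOf σ s,
            (uu - RatFunc.C (brk (zb (s.1 + 1, s.2 + 1) - hup σ b)))) *
        ((∏ b ∈ colOf (σ.erase s) s,
            (uu - RatFunc.C (brk (zb (s.1 + 1, s.2 + 1) + hlo (σ.erase s) b)))) /
          ∏ b ∈ colOf σ s,
            (uu - RatFunc.C (brk (zb (s.1 + 1, s.2 + 1) + hlo σ b)))) := by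
  obtain ⟨p, q⟩ := s
  obtain ⟨hmem, hright, habove⟩ := Finset.mem_filter.1 hs
  let μ : YoungDiagram := ⟨σ, hσ⟩
  have hrow : ∀ x y, (x, y) ∈ σ ↔ y < μ.rowLen x := fun _ _ => μ.mem_iff_lt_rowLen
  have hcol : ∀ x y, (x, y) ∈ σ ↔ x < μ.colLen y := fun _ _ => μ.mem_iff_lt_colLen
  have hp : μ.rowLen p = q + 1 := by
    rw [hrow] at hmem habove
    dsimp only at hmem habove
    omega
  have hq : μ.colLen q = p + 1 := by
    rw [hcol] at hmem hright
    dsimp only at hmem hright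
    omega
  have hrowErase : ∀ x, (x, q) ∈ σ.erase (p, q) ↔ x < p := fun x => by
    rw [Finset.mem_erase, hcol, hq, Ne, Prod.mk.injEq]
    omega
  have hcolErase : ∀ y, (p, y) ∈ σ.erase (p, q) ↔ y < q := fun y => by
    rw [Finset.mem_erase, hrow, hp, Ne, Prod.mk.injEq]
    omega
  have hrowLen : ∀ x < p + 1, q < μ.rowLen x := fun x hx => by rwa [← hrow, hcol, hq]
  have hcolLen : ∀ y < q + 1, p < μ.colLen y := fun y hy => by rwa [← hcol, hrow, hp]
  have hTS : TS σ = ∏ b ∈ μ.cells, linFactor b.1 b.2 * linFactor (b.1 + 1) (b.2 + 1) /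
      (linFactor (b.1 + 1) b.2 * linFactor b.1 (b.2 + 1)) :=
    Finset.prod_congr rfl fun b _ => Tbox_uu_sub b.1 b.2
  rw [hTS, prod_cross_ratio_corner linFactor_ne_zero μ hp hq, linFactor_zero_zero,
    prod_rowOf hrowErase, prod_colOf hcolErase,
    prod_rowOf (n := p + 1) (fun x => by rw [hcol, hq]),
    prod_colOf (n := q + 1) (fun y => by rw [hrow, hp])]
  congr 1
  · congr 1
    congr 1
    · refine Finset.prod_congr rfl fun x hx => (uu_sub_brk_eq_linFactor ?_ ?_).symm
      all_goals
        have hx := Finset.mem_range.1 hx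
        have := hrowLen x (by omega)
      · simp only [zb, hup, Prod.fst_sub, arm_eq fun i _ => hrowErase i]
        omega
      · simp only [zb, hup, Prod.snd_sub, leg_eq fun j (_ : q < j) =>
          (show (x, j) ∈ σ.erase (p, q) ↔ j < μ.rowLen x by
            rw [Finset.mem_erase, hrow, Ne, Prod.mk.injEq]; omega)]
        omega
    · refine Finset.prod_congr rfl fun x hx => (uu_sub_brk_eq_linFactor ?_ ?_).symm
      all_goals
        have hx := Finset.mem_range.1 hx
        have := hrowLen x hx
      · simp only [zb, hup, Prod.fst_sub, arm_eq fun i _ => hcol i q, hq]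
        omega
      · simp only [zb, hup, Prod.snd_sub, leg_eq fun j _ => hrow x j]
        omega
  · congr 1
    · refine Finset.prod_congr rfl fun y hy => (uu_sub_brk_eq_linFactor ?_ ?_).symm
      all_goals
        have hy := Finset.mem_range.1 hy
        have := hcolLen y (by omega)
      · simp only [zb, hlo, Prod.fst_add, arm_eq fun i (_ : p < i) =>
          (show (i, y) ∈ σ.erase (p, q) ↔ i < μ.colLen y by
            rw [Finset.mem_erase, hcol, Ne, Prod.mk.injEq]; omega)]
        omega
      · simp only [zb, hlo, Prod.snd_add, leg_eq fun j _ => hcolErase j]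
        omega
    · refine Finset.prod_congr rfl fun y hy => (uu_sub_brk_eq_linFactor ?_ ?_).symm
      all_goals
        have hy := Finset.mem_range.1 hy
        have := hcolLen y hy
      · simp only [zb, hlo, Prod.fst_add, arm_eq fun i _ => hcol i y]
        omega
      · simp only [zb, hlo, Prod.snd_add, leg_eq fun j _ => hrow p j, hp]
        omega

end JackLR
end
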